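/- Let 𝒞 be a category with pullbacks. Let f : X ⟶ Y be a morphism admitting a section s : Y ⟶ X (so f ∘ s = 𝟙_Y). Let P be an object with morphisms p₀, p₁ : P ⟶ X satisfying f ∘ p₀ = f ∘ p₁, and suppose the induced morphism ⟨p₀, p₁⟩ : P ⟶ X ×_Y X admits a section t. Then f is a retract of p₁ in the arrow category of 𝒞, via the factorisation X ⟶ X ×_Y X ⟶ P ⟶ X given by ⟨𝟙_X, s ∘ f⟩ followed by t followed by p₀ on top, and Y ⟶ X ⟶ Y given by s followed by f on the bottom. Consequently f has the right lifting property against every morphism against which p₁ does; in particular, if p₁ is a trivial fibration with respect to a class Cof, then so is f. (This is the key step of the proposition that an hproposition with a section is a trivial fibration, taking P to be the relative path object P_Y(X).) -/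

import Mathlib

open CategoryTheory Limits

/-- If `f : X ⟶ Y` has a section `s`, and `p₀, p₁ : P ⟶ X` satisfy
`f ∘ p₀ = f ∘ p₁` and the induced map `⟨p₀, p₁⟩ : P ⟶ X ×_Y X` has a section `t`,
then `f` is a retract of `p₁` in the arrow category, via the top map
`⟨𝟙_X, s ∘ f⟩ ≫ t : X ⟶ P` (with retraction `p₀`) and bottom maps `s` and `f`
(the identities `(⟨𝟙_X, s∘f⟩ ≫ t) ≫ p₀ = 𝟙 X` and `s ≫ f = 𝟙 Y` exhibit the
retract, the square conditions being `(⟨𝟙_X, s∘f⟩ ≫ t) ≫ p₁ = f ≫ s` and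
`p₀ ≫ f = p₁ ≫ f`).  Consequently `f` has the right lifting property against
every morphism against which `p₁` does; in particular if `p₁` is a trivial
fibration so is `f`. -/
theorem stmt_4 {𝒞 : Type u} [Category.{v} 𝒞] [HasPullbacks 𝒞]
    {X Y P : 𝒞} (f : X ⟶ Y) (s : Y ⟶ X) (hs : s ≫ f = 𝟙 Y)
    (p₀ p₁ : P ⟶ X) (hp : p₀ ≫ f = p₁ ≫ f)
    (t : pullback f f ⟶ P) (ht : t ≫ pullback.lift p₀ p₁ hp = 𝟙 (pullback f f)) :
    ((pullback.lift (𝟙 X) (f ≫ s)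
        (by rw [Category.id_comp, Category.assoc, hs, Category.comp_id]) ≫ t) ≫ p₁
      = f ≫ s) ∧
    ((pullback.lift (𝟙 X) (f ≫ s)
        (by rw [Category.id_comp, Category.assoc, hs, Category.comp_id]) ≫ t) ≫ p₀
      = 𝟙 X) ∧
    (∀ {A B : 𝒞} (g : A ⟶ B), HasLiftingProperty g p₁ → HasLiftingProperty g f) := by
  have ht₀ : t ≫ p₀ = pullback.fst f f := by
    have h : (t ≫ pullback.lift p₀ p₁ hp) ≫ pullback.fst f f = 𝟙 _ ≫ pullback.fst f f := by
      rw [ht]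
    rwa [Category.assoc, pullback.lift_fst, Category.id_comp] at h
  have ht₁ : t ≫ p₁ = pullback.snd f f := by
    have h : (t ≫ pullback.lift p₀ p₁ hp) ≫ pullback.snd f f = 𝟙 _ ≫ pullback.snd f f := by
      rw [ht]
    rwa [Category.assoc, pullback.lift_snd, Category.id_comp] at h
  have hw : 𝟙 X ≫ f = (f ≫ s) ≫ f := by
    rw [Category.id_comp, Category.assoc, hs, Category.comp_id]
  have h₁ : (pullback.lift (𝟙 X) (f ≫ s) hw ≫ t) ≫ p₁ = f ≫ s := by
    rw [Category.assoc, ht₁, pullback.lift_snd]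
  have h₀ : (pullback.lift (𝟙 X) (f ≫ s) hw ≫ t) ≫ p₀ = 𝟙 X := by
    rw [Category.assoc, ht₀, pullback.lift_fst]
  refine ⟨h₁, h₀, ?_⟩
  intro A B g hg
  generalize pullback.lift (𝟙 X) (f ≫ s) hw ≫ t = i at h₀ h₁
  refine ⟨fun {u v} sq => ?_⟩
  have sq' : CommSq (u ≫ i) g p₁ (v ≫ s) :=
    ⟨by rw [Category.assoc, h₁, ← Category.assoc, sq.w, Category.assoc]⟩
  refine ⟨⟨⟨sq'.lift ≫ p₀, ?_, ?_⟩⟩⟩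
  · rw [← Category.assoc, sq'.fac_left, Category.assoc, h₀, Category.comp_id]
  · rw [Category.assoc, hp, ← Category.assoc, sq'.fac_right, Category.assoc, hs,
      Category.comp_id]
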